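/- Assume the Continuum Hypothesis fails, and let Φ : 𝓑 → 𝓑 be a lower density operator on the Borel subsets of ℝ × ℝ with respect to the σ-ideal of countable sets. Then there exists x ∈ ℝ such that the set {t ∈ ℝ : x ∈ π₂[Φ({t} × ℝ)]} is uncountable, where π₂ : ℝ × ℝ → ℝ is the projection onto the second coordinate. -/

import Mathlib

open Set Cardinal

/-- `Φ` is a lower density operator on the Borel σ-algebra of `X` with respect to the
σ-ideal of countable sets: it maps Borel sets to Borel sets and satisfies (1)–(4). -/
def IsCountableLowerDensity {X : Type*} [MeasurableSpace X] (Φ : Set X → Set X) : Prop :=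
  (∀ A : Set X, MeasurableSet A → MeasurableSet (Φ A)) ∧
  (Φ Set.univ = Set.univ ∧ Φ ∅ = ∅) ∧
  (∀ A B : Set X, MeasurableSet A → MeasurableSet B →
    (symmDiff A B).Countable → Φ A = Φ B) ∧
  (∀ A : Set X, MeasurableSet A → (symmDiff A (Φ A)).Countable) ∧
  (∀ A B : Set X, MeasurableSet A → MeasurableSet B → Φ (A ∩ B) = Φ A ∩ Φ B)

theorem exists_uncountable_fiber_of_not_ch
    (hCH : Cardinal.aleph 1 < Cardinal.continuum)
    (Φ : Set (ℝ × ℝ) → Set (ℝ × ℝ)) (hΦ : IsCountableLowerDensity Φ) :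
    ∃ x : ℝ, ¬ Set.Countable
      {t : ℝ | x ∈ Prod.snd '' Φ (({t} : Set ℝ) ×ˢ (Set.univ : Set ℝ))} := by
  obtain ⟨-, -, -, hsymm, -⟩ := hΦ
  have hlt₀ : aleph.{0} 1 < continuum.{0} := by
    rw [← lift_lt, lift_aleph, lift_continuum, Ordinal.lift_one]
    exact hCH
  obtain ⟨T, hT⟩ : ∃ T : Set ℝ, #T = aleph 1 :=
    le_mk_iff_exists_set.1 (by rw [mk_real]; exact hlt₀.le)
  let E : ℝ → Set ℝ := fun t => {x | (t, x) ∉ Φ (({t} : Set ℝ) ×ˢ (Set.univ : Set ℝ))}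
  have hE : ∀ t, (E t).Countable := fun t =>
    ((hsymm _ ((measurableSet_singleton t).prod MeasurableSet.univ)).preimage
      (Prod.mk_right_injective t)).mono fun x hx => Or.inl ⟨by simp, hx⟩
  have hlt : #(⋃ t : T, E t : Set ℝ) < #ℝ := by
    rw [mk_real]
    refine lt_of_le_of_lt ((mk_iUnion_le _).trans ?_) hlt₀
    refine mul_le_of_le (aleph0_le_aleph 1) hT.le ?_
    exact ciSup_le' fun t => (hE t).le_aleph0.trans (aleph0_le_aleph 1)
  obtain ⟨x, hx⟩ : ∃ x, x ∉ ⋃ t : T, E t := by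
    by_contra! h
    rw [eq_univ_of_forall h, mk_univ] at hlt
    exact hlt.false
  refine ⟨x, fun hc => ?_⟩
  have hsub : T ⊆ {t : ℝ | x ∈ Prod.snd '' Φ (({t} : Set ℝ) ×ˢ (Set.univ : Set ℝ))} :=
    fun t ht => ⟨(t, x), by_contra fun h => hx (mem_iUnion.2 ⟨⟨t, ht⟩, h⟩), rfl⟩
  have hle := (hc.mono hsub).le_aleph0
  rw [hT] at hle
  exact aleph0_lt_aleph_one.not_ge hle
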